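/- Suppose m ≡ 22 (mod 48). Then j′ ∈ J, P(j′) ≠ 0, and for every j ∈ J with j ∉ {j′, j″, j‴}, either P(j) = 0 or V(j) < V(j′). -/

import Mathlib

open Finset

/-- `s a` is the sum of the binary digits of `a`. -/
def sdig (a : ℕ) : ℕ := (Nat.digits 2 a).sum

/-- `carries a b` is the number of carries when adding `a` and `b` in base 2:
`c(a,b) = s(a) + s(b) - s(a+b)`. -/
def carries (a b : ℕ) : ℕ := sdig a + sdig b - sdig (a + b)

/-- The generalized binomial coefficient `C_r(x) = x(x-1)⋯(x-r+1)/r!` (with `C_0(x) = 1`). -/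
def genBinom (x : ℚ) (r : ℕ) : ℚ :=
  (∏ p ∈ Finset.range r, (x - p)) / (Nat.factorial r : ℚ)

/-- Membership in the index set `J`: here `j i` (for `i : Fin n`) is the paper's
`j_{i+1}`, so the defining relation `(2^n-1)j_1 + ⋯ + (2-1)j_n = m+1` becomes
`∑ k, (2^(n-k) - 1) * j k = m + 1`. -/
def inJ (n m : ℕ) (j : Fin n → ℕ) : Prop :=
  ∑ k : Fin n, (2 ^ (n - (k : ℕ)) - 1) * j k = m + 1

/-- `α_j(k)`: for `K : Fin n`, `alphaF n m j K` is the paper's `α_j(K+1)`, i.e.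
`m / 2^(n-K) - ∑_{I < K} 2^(K-I) j_{I+1}`. -/
def alphaF (n m : ℕ) (j : Fin n → ℕ) (K : Fin n) : ℚ :=
  (m : ℚ) / 2 ^ (n - (K : ℕ)) -
    ∑ I : Fin n, if (I : ℕ) < (K : ℕ) then 2 ^ ((K : ℕ) - (I : ℕ)) * (j I : ℚ) else 0

/-- `P(j) = ∏_{k=1}^n C_{j_k}(α_j(k))`. -/
def Pprod (n m : ℕ) (j : Fin n → ℕ) : ℚ :=
  ∏ k : Fin n, genBinom (alphaF n m j k) (j k)

/-- `V(j) = -ν(P(j))`, where `ν` is the 2-adic valuation on `ℚ`. -/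
def V (n m : ℕ) (j : Fin n → ℕ) : ℤ := - padicValRat 2 (Pprod n m j)

theorem sdig_eq_mod_add_div (a : ℕ) : sdig a = a % 2 + sdig (a / 2) := by
  rcases Nat.eq_zero_or_pos a with rfl | h
  · simp [sdig]
  · simp [sdig, Nat.digits_def' one_lt_two h]

theorem sdig_add_le (a b : ℕ) : sdig (a + b) ≤ sdig a + sdig b := by
  induction a using Nat.strong_induction_on generalizing b with
  | _ a ih =>
    rcases Nat.eq_zero_or_pos a with rfl | h
    · simp
    have h1 := sdig_eq_mod_add_div a
    have h2 := sdig_eq_mod_add_div b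
    have h3 := sdig_eq_mod_add_div (a + b)
    have h4 := ih (a / 2) (by omega) (b / 2)
    by_cases hc : a % 2 = 1 ∧ b % 2 = 1
    · have h5 : (a + b) / 2 = a / 2 + (b / 2 + 1) := by omega
      have h6 := ih (a / 2) (by omega) (b / 2 + 1)
      have h7 : sdig (b / 2 + 1) ≤ sdig (b / 2) + 1 := by
        clear ih h1 h2 h3 h4 h5 h6 hc
        induction b / 2 using Nat.strong_induction_on with
        | _ c ihc =>
          have h1 := sdig_eq_mod_add_div c
          have h3 := sdig_eq_mod_add_div (c + 1)
          rcases Nat.even_or_odd' c with ⟨d, rfl | rfl⟩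
          · rw [show (2 * d + 1) / 2 = 2 * d / 2 by omega] at h3
            omega
          · have := ihc d (by omega)
            rw [show (2 * d + 1 + 1) / 2 = d + 1 by omega] at h3
            rw [show (2 * d + 1) / 2 = d by omega] at h1
            omega
      rw [h5] at h3
      omega
    · have h5 : (a + b) / 2 = a / 2 + b / 2 := by omega
      rw [h5] at h3
      omega

theorem sdig_le_self (a : ℕ) : sdig a ≤ a := Nat.digit_sum_le 2 a

theorem sdig_pos {a : ℕ} (h : 0 < a) : 0 < sdig a := by
  induction a using Nat.strong_induction_on with
  | _ a ih =>
    have h1 := sdig_eq_mod_add_div a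
    rcases Nat.even_or_odd' a with ⟨d, rfl | rfl⟩
    · have := ih d (by omega) (by omega)
      rw [show 2 * d / 2 = d by omega] at h1
      omega
    · omega

theorem sdig_le_div_eight (d : ℕ) : sdig d ≤ d / 8 + 3 := by
  have h1 := sdig_eq_mod_add_div d
  have h2 := sdig_eq_mod_add_div (d / 2)
  have h3 := sdig_eq_mod_add_div (d / 2 / 2)
  have h4 := sdig_le_self (d / 2 / 2 / 2)
  omega

theorem sdig_sixteen_mul_add_seven (q : ℕ) : sdig (16 * q + 7) = sdig q + 3 := by
  have h1 := sdig_eq_mod_add_div (16 * q + 7)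
  rw [show (16 * q + 7) / 2 = 8 * q + 3 by omega] at h1
  have h2 := sdig_eq_mod_add_div (8 * q + 3)
  rw [show (8 * q + 3) / 2 = 4 * q + 1 by omega] at h2
  have h3 := sdig_eq_mod_add_div (4 * q + 1)
  rw [show (4 * q + 1) / 2 = 2 * q by omega] at h3
  have h4 := sdig_eq_mod_add_div (2 * q)
  rw [show (2 * q) / 2 = q by omega] at h4
  omega

theorem padicValRat_factorial_two (r : ℕ) :
    padicValRat 2 (r.factorial : ℚ) = r - sdig r := by
  have h := sub_one_mul_padicValNat_factorial (p := 2) r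
  have h1 := sdig_le_self r
  simp only [Nat.add_one_sub_one, one_mul] at h
  rw [padicValRat.of_nat, h]
  unfold sdig at *
  omega

theorem padicValRat_finset_prod {ι : Type*} (p : ℕ) [Fact p.Prime] (s : Finset ι) (f : ι → ℚ)
    (h : ∀ i ∈ s, f i ≠ 0) :
    padicValRat p (∏ i ∈ s, f i) = ∑ i ∈ s, padicValRat p (f i) := by
  classical
  induction s using Finset.induction_on with
  | empty => simp
  | insert a s ha ih =>
    rw [Finset.prod_insert ha, Finset.sum_insert ha, padicValRat.mul, ih]
    · exact fun i hi => h i (Finset.mem_insert_of_mem hi)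
    · exact h a (Finset.mem_insert_self _ _)
    · exact Finset.prod_ne_zero_iff.mpr fun i hi => h i (Finset.mem_insert_of_mem hi)

theorem padicValRat_sub_intCast {p : ℕ} [Fact p.Prime] {x : ℚ} (hx : padicValRat p x < 0)
    (z : ℤ) : x - z ≠ 0 ∧ padicValRat p (x - z) = padicValRat p x := by
  have hz : 0 ≤ padicValRat p (z : ℚ) := by simp
  have hne : x - z ≠ 0 := by
    intro h
    rw [sub_eq_zero.mp h] at hx
    omega
  refine ⟨hne, ?_⟩
  rcases eq_or_ne z 0 with rfl | h0
  · simp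
  have hx0 : x ≠ 0 := by rintro rfl; simp at hx
  rw [sub_eq_add_neg] at hne ⊢
  refine padicValRat.add_eq_of_lt hne hx0 (by simpa using h0) ?_
  rw [padicValRat.neg]
  omega

theorem genBinom_ne_zero_of_padicValRat_neg {x : ℚ} (hx : padicValRat 2 x < 0) (r : ℕ) :
    genBinom x r ≠ 0 := by
  refine div_ne_zero (Finset.prod_ne_zero_iff.mpr fun p _ => ?_)
    (by exact_mod_cast r.factorial_ne_zero)
  simpa using (padicValRat_sub_intCast hx p).1

theorem padicValRat_genBinom {x : ℚ} (hx : padicValRat 2 x < 0) (r : ℕ) :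
    padicValRat 2 (genBinom x r) = r * padicValRat 2 x - (r - sdig r) := by
  have hne : ∀ p ∈ range r, x - (p : ℚ) ≠ 0 := fun p _ => by
    simpa using (padicValRat_sub_intCast hx p).1
  rw [genBinom, padicValRat.div (Finset.prod_ne_zero_iff.mpr hne)
    (by exact_mod_cast r.factorial_ne_zero), padicValRat_factorial_two,
    padicValRat_finset_prod 2 _ _ hne, Finset.sum_congr rfl (g := fun _ => padicValRat 2 x)]
  · simp
  · intro p _
    simpa using (padicValRat_sub_intCast hx p).2

theorem exists_int_genBinom (z : ℤ) (r : ℕ) : ∃ w : ℤ, genBinom z r = w := by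
  obtain ⟨c, hc⟩ := Nat.factorial_coe_dvd_prod r (-z)
  refine ⟨(-1) ^ r * c, ?_⟩
  have hf : (r.factorial : ℚ) ≠ 0 := by exact_mod_cast r.factorial_ne_zero
  have hp : ∏ p ∈ range r, ((z : ℚ) - p) = (-1) ^ r * ∏ p ∈ range r, (-(z : ℚ) + p) := by
    rw [← Finset.card_range r, ← Finset.prod_const, Finset.card_range, ← Finset.prod_mul_distrib]
    exact Finset.prod_congr rfl fun p _ => by ring
  have hc' : ∏ p ∈ range r, (-(z : ℚ) + p) = r.factorial * c := by exact_mod_cast hc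
  rw [genBinom, hp, hc', div_eq_iff hf]
  push_cast
  ring

theorem padicValRat_genBinom_intCast_nonneg (z : ℤ) (r : ℕ) :
    0 ≤ padicValRat 2 (genBinom z r) := by
  obtain ⟨w, hw⟩ := exists_int_genBinom z r
  simp [hw]

theorem exists_int_alphaF (n m : ℕ) (j : Fin n → ℕ) (K : Fin n) :
    ∃ z : ℤ, alphaF n m j K = (m : ℚ) / 2 ^ (n - (K : ℕ)) - z := by
  refine ⟨∑ I : Fin n, if (I : ℕ) < (K : ℕ) then 2 ^ ((K : ℕ) - (I : ℕ)) * (j I : ℤ) else 0, ?_⟩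
  simp only [alphaF]
  push_cast
  rfl

theorem padicValRat_alphaF {n m : ℕ} (hm : m % 4 = 2) (j : Fin n → ℕ) (K : Fin n)
    (hK : (K : ℕ) + 1 < n) : padicValRat 2 (alphaF n m j K) = 1 - ((n : ℤ) - K) := by
  obtain ⟨z, hz⟩ := exists_int_alphaF n m j K
  obtain ⟨t, rfl⟩ : ∃ t, m = 2 * (2 * t + 1) := ⟨m / 4, by omega⟩
  have hv : padicValRat 2 (((2 * (2 * t + 1) : ℕ) : ℚ) / 2 ^ (n - (K : ℕ)))
      = 1 - ((n : ℤ) - K) := by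
    have h1 : padicValNat 2 (2 * (2 * t + 1)) = 1 := by
      rw [padicValNat.mul (by norm_num) (by omega), padicValNat_self,
        padicValNat.eq_zero_of_not_dvd (by omega)]
    have h2 : ((2 : ℕ) : ℚ) = 2 := by norm_num
    rw [padicValRat.div (by positivity) (by positivity), padicValRat.of_nat, h1, ← h2,
      padicValRat.pow, padicValRat.self one_lt_two]
    push_cast [Nat.cast_sub K.2.le]
    ring
  rw [hz, (padicValRat_sub_intCast (by rw [hv]; omega) z).2, hv]

theorem exists_int_alphaF_last {N m : ℕ} (hm : m % 4 = 2) (j : Fin (N + 1) → ℕ) :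
    ∃ z : ℤ, alphaF (N + 1) m j (Fin.last N) = z := by
  obtain ⟨z, hz⟩ := exists_int_alphaF (N + 1) m j (Fin.last N)
  obtain ⟨t, rfl⟩ : ∃ t, m = 2 * t := ⟨m / 2, by omega⟩
  refine ⟨t - z, ?_⟩
  rw [hz]
  simp

theorem V_eq {N m : ℕ} (hm : m % 4 = 2) (j : Fin (N + 1) → ℕ) (hP : Pprod (N + 1) m j ≠ 0) :
    V (N + 1) m j =
      ∑ k : Fin N, (((N : ℤ) + 1 - k) * j k.castSucc - sdig (j k.castSucc)) -
        padicValRat 2 (genBinom (alphaF (N + 1) m j (Fin.last N)) (j (Fin.last N))) := by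
  rw [V, Pprod, padicValRat_finset_prod]
  · rw [Fin.sum_univ_castSucc, neg_add, ← Finset.sum_neg_distrib, sub_eq_add_neg]
    congr 1
    refine Finset.sum_congr rfl fun k _ => ?_
    have hv := padicValRat_alphaF hm j k.castSucc (by simp)
    have hk := k.2
    rw [padicValRat_genBinom (by rw [hv, Fin.val_castSucc]; omega), hv]
    simp
    ring
  · exact fun i _ => Finset.prod_ne_zero_iff.mp hP i (Finset.mem_univ i)

theorem seven_mul_le_three_mul_two_pow_sub_one {i : ℕ} (hi : 3 ≤ i) :
    7 * i ≤ 3 * (2 ^ i - 1) := by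
  induction i, hi using Nat.le_induction with
  | base => norm_num
  | succ i hi ih =>
    rw [pow_succ]
    omega

theorem digit_sum_bound {q X Y Z a b c : ℕ} (hJ : X + 7 * c + 3 * b + a = 48 * q + 23)
    (hXY : 7 * Y ≤ 3 * X) (hX : X = 0 ∨ 15 ≤ X ∧ 1 ≤ Z)
    (h1 : ¬ (X = 0 ∧ c = 0 ∧ b = 16 * q + 7 ∧ a = 2))
    (h2 : ¬ (X = 0 ∧ c = 0 ∧ b = 16 * q + 6 ∧ a = 5))
    (h3 : ¬ (X = 0 ∧ c = 1 ∧ b = 16 * q + 5 ∧ a = 1)) :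
    Y + 3 * c + 2 * b + sdig q < 32 * q + 10 + Z + sdig c + sdig b := by
  obtain ⟨d, hd⟩ : ∃ d, b + d = 16 * q + 7 := ⟨16 * q + 7 - b, by omega⟩
  have hs := sdig_add_le b d
  rw [hd, sdig_sixteen_mul_add_seven] at hs
  have hd8 := sdig_le_div_eight d
  have hd1 := sdig_le_self d
  have hc0 : c = 0 ∨ 0 < sdig c := (Nat.eq_zero_or_pos c).imp_right sdig_pos
  have e2 : sdig 2 = 1 := by norm_num [sdig]
  have e3 : sdig 3 = 2 := by norm_num [sdig]
  have e4 : sdig 4 = 1 := by norm_num [sdig]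
  have e5 : sdig 5 = 2 := by norm_num [sdig]
  have e6 : sdig 6 = 2 := by norm_num [sdig]
  rcases lt_or_ge d 7 with h | h
  · interval_cases d <;> omega
  · omega

theorem inJ_add_three_iff {N m : ℕ} (j : Fin (N + 3) → ℕ) :
    inJ (N + 3) m j ↔
      ∑ k : Fin N, (2 ^ (N + 3 - (k : ℕ)) - 1) * j k.castSucc.castSucc.castSucc +
        7 * j (Fin.last N).castSucc.castSucc + 3 * j (Fin.last (N + 1)).castSucc +
        j (Fin.last (N + 2)) = m + 1 := by
  have h3 : N + 3 - N = 3 := by omega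
  have h2 : N + 3 - (N + 1) = 2 := by omega
  have h1 : N + 3 - (N + 2) = 1 := by omega
  simp [inJ, Fin.sum_univ_castSucc, h1, h2, h3]

theorem V_add_three_eq {N m : ℕ} (hm : m % 4 = 2) (j : Fin (N + 3) → ℕ)
    (hP : Pprod (N + 3) m j ≠ 0) :
    V (N + 3) m j =
      ((∑ k : Fin N, (N + 3 - (k : ℕ)) * j k.castSucc.castSucc.castSucc : ℕ) : ℤ) -
        ((∑ k : Fin N, sdig (j k.castSucc.castSucc.castSucc) : ℕ) : ℤ) +
        (3 * j (Fin.last N).castSucc.castSucc - sdig (j (Fin.last N).castSucc.castSucc)) +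
        (2 * j (Fin.last (N + 1)).castSucc - sdig (j (Fin.last (N + 1)).castSucc)) -
        padicValRat 2 (genBinom (alphaF (N + 3) m j (Fin.last (N + 2))) (j (Fin.last (N + 2)))) := by
  rw [V_eq hm j hP, Fin.sum_univ_castSucc, Fin.sum_univ_castSucc]
  push_cast
  rw [← Finset.sum_sub_distrib]
  congr 1
  congr 1
  · congr 1
    · refine Finset.sum_congr rfl fun k _ => ?_
      have hk := k.2
      rw [Nat.cast_sub (by omega)]
      push_cast [Fin.val_castSucc]
      ring
    · push_cast [Fin.val_castSucc, Fin.val_last]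
      ring
  · ring

theorem funext_add_three {N : ℕ} {f g : Fin (N + 3) → ℕ}
    (h : ∀ k : Fin N, f k.castSucc.castSucc.castSucc = g k.castSucc.castSucc.castSucc)
    (h3 : f (Fin.last N).castSucc.castSucc = g (Fin.last N).castSucc.castSucc)
    (h2 : f (Fin.last (N + 1)).castSucc = g (Fin.last (N + 1)).castSucc)
    (h1 : f (Fin.last (N + 2)) = g (Fin.last (N + 2))) : f = g := by
  funext k
  refine Fin.lastCases h1 (fun k => ?_) k
  refine Fin.lastCases h2 (fun k => ?_) k
  exact Fin.lastCases h3 h k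

theorem V_lt_of_digit_sum_bound {N q : ℕ} (j : Fin (N + 3) → ℕ)
    (hJ : inJ (N + 3) (48 * q + 22) j) (hP : Pprod (N + 3) (48 * q + 22) j ≠ 0)
    (h : ∀ c b a, (c = 0 ∧ b = 16 * q + 7 ∧ a = 2) ∨ (c = 0 ∧ b = 16 * q + 6 ∧ a = 5) ∨
        (c = 1 ∧ b = 16 * q + 5 ∧ a = 1) →
      ¬ ((∀ k : Fin N, j k.castSucc.castSucc.castSucc = 0) ∧
        j (Fin.last N).castSucc.castSucc = c ∧ j (Fin.last (N + 1)).castSucc = b ∧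
        j (Fin.last (N + 2)) = a)) :
    V (N + 3) (48 * q + 22) j < 32 * q + 10 - sdig q := by
  have hV := V_add_three_eq (by omega) j hP
  obtain ⟨z, hz⟩ := exists_int_alphaF_last (m := 48 * q + 22) (by omega) j
  have hnn := padicValRat_genBinom_intCast_nonneg z (j (Fin.last (N + 2)))
  rw [hz] at hV
  rw [inJ_add_three_iff] at hJ
  have hpow (k : Fin N) : 15 ≤ 2 ^ (N + 3 - (k : ℕ)) - 1 := by
    have hk := k.2
    have := Nat.pow_le_pow_right (n := 2) two_pos (show 4 ≤ N + 3 - (k : ℕ) by omega)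
    omega
  have hXY : 7 * ∑ k : Fin N, (N + 3 - (k : ℕ)) * j k.castSucc.castSucc.castSucc ≤
      3 * ∑ k : Fin N, (2 ^ (N + 3 - (k : ℕ)) - 1) * j k.castSucc.castSucc.castSucc := by
    rw [Finset.mul_sum, Finset.mul_sum]
    refine Finset.sum_le_sum fun k _ => ?_
    rw [← mul_assoc, ← mul_assoc]
    have hk := k.2
    exact Nat.mul_le_mul_right _ (seven_mul_le_three_mul_two_pow_sub_one (by omega))
  have hzero : ∑ k : Fin N, (2 ^ (N + 3 - (k : ℕ)) - 1) * j k.castSucc.castSucc.castSucc = 0 →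
      ∀ k : Fin N, j k.castSucc.castSucc.castSucc = 0 := by
    intro h0 k
    have hk := (Finset.sum_eq_zero_iff.mp h0) k (Finset.mem_univ k)
    have := hpow k
    exact (Nat.mul_eq_zero.mp hk).resolve_left (by omega)
  have hX : ∑ k : Fin N, (2 ^ (N + 3 - (k : ℕ)) - 1) * j k.castSucc.castSucc.castSucc = 0 ∨
      15 ≤ ∑ k : Fin N, (2 ^ (N + 3 - (k : ℕ)) - 1) * j k.castSucc.castSucc.castSucc ∧
      1 ≤ ∑ k : Fin N, sdig (j k.castSucc.castSucc.castSucc) := by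
    by_cases hall : ∀ k : Fin N, j k.castSucc.castSucc.castSucc = 0
    · exact Or.inl (Finset.sum_eq_zero fun k _ => by rw [hall k, mul_zero])
    · push Not at hall
      obtain ⟨k, hk⟩ := hall
      have hk' := Nat.pos_of_ne_zero hk
      refine Or.inr ⟨le_trans ?_ (Finset.single_le_sum (fun i _ => Nat.zero_le _)
        (Finset.mem_univ k)), le_trans (sdig_pos hk') (Finset.single_le_sum
        (f := fun k : Fin N => sdig (j k.castSucc.castSucc.castSucc))
        (fun i _ => Nat.zero_le _) (Finset.mem_univ k))⟩
      exact Nat.mul_le_mul (hpow k) hk'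
  have hb := digit_sum_bound hJ hXY hX
    (fun ⟨h0, h'⟩ => h _ _ _ (Or.inl ⟨rfl, rfl, rfl⟩) ⟨hzero h0, h'⟩)
    (fun ⟨h0, h'⟩ => h _ _ _ (Or.inr (Or.inl ⟨rfl, rfl, rfl⟩)) ⟨hzero h0, h'⟩)
    (fun ⟨h0, h'⟩ => h _ _ _ (Or.inr (Or.inr ⟨rfl, rfl, rfl⟩)) ⟨hzero h0, h'⟩)
  omega

theorem alphaF_last_eq {N q : ℕ} (j : Fin (N + 3) → ℕ)
    (h : ∀ k : Fin N, j k.castSucc.castSucc.castSucc = 0)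
    (h3 : j (Fin.last N).castSucc.castSucc = 0)
    (h2 : j (Fin.last (N + 1)).castSucc = 16 * q + 7) :
    alphaF (N + 3) (48 * q + 22) j (Fin.last (N + 2)) = -(8 * q + 3) := by
  have e2 : N + 2 - (N + 1) = 1 := by omega
  have e1 : N + 3 - (N + 2) = 1 := by omega
  simp [alphaF, Fin.sum_univ_castSucc, h, h3, h2, e1, e2]
  ring

theorem genBinom_neg_two (q : ℕ) :
    genBinom (-(8 * (q : ℚ) + 3)) 2 = ((2 * ((8 * q + 3) * (2 * q + 1)) : ℕ) : ℚ) := by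
  simp [genBinom, Finset.prod_range_succ, Nat.factorial]
  ring

theorem padicValRat_genBinom_neg_two (q : ℕ) :
    padicValRat 2 (genBinom (-(8 * (q : ℚ) + 3)) 2) = 1 := by
  rw [genBinom_neg_two, padicValRat.of_nat, padicValNat.mul (by norm_num) (by positivity),
    padicValNat_self, padicValNat.eq_zero_of_not_dvd]
  · simp
  · rw [Nat.prime_two.dvd_mul]
    omega

/-- If `m ≡ 22 mod 48`, then `j' ∈ J`, `P(j') ≠ 0`, and every `j ∈ J` outside
`{j', j'', j‴}` has `P(j) = 0` or `V(j) < V(j')`. -/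
theorem stmt15 (n m : ℕ) (hn : 3 ≤ n) (hm : 1 ≤ m) (hmn : m ≤ 2 ^ (n + 1) - 3)
    (h48 : m % 48 = 22)
    (j1 : Fin n → ℕ)
    (hj1 : j1 = fun k : Fin n =>
      if (k : ℕ) = n - 2 then (m - 1) / 3 else if (k : ℕ) = n - 1 then 2 else 0)
    (j2 : Fin n → ℕ)
    (hj2 : j2 = fun k : Fin n =>
      if (k : ℕ) = n - 2 then (m - 4) / 3 else if (k : ℕ) = n - 1 then 5 else 0)
    (j3 : Fin n → ℕ)
    (hj3 : j3 = fun k : Fin n =>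
      if (k : ℕ) = n - 3 then 1
      else if (k : ℕ) = n - 2 then (m - 7) / 3
      else if (k : ℕ) = n - 1 then 1 else 0) :
    inJ n m j1 ∧ Pprod n m j1 ≠ 0 ∧
      ∀ j : Fin n → ℕ, inJ n m j → j ≠ j1 → j ≠ j2 → j ≠ j3 →
        Pprod n m j = 0 ∨ V n m j < V n m j1 := by
  obtain ⟨N, rfl⟩ : ∃ N, n = N + 3 := ⟨n - 3, by omega⟩
  obtain ⟨q, rfl⟩ : ∃ q, m = 48 * q + 22 := ⟨m / 48, by omega⟩
  have e1 : N + 3 - 1 = N + 2 := by omega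
  have e2 : N + 3 - 2 = N + 1 := by omega
  have e3 : N + 3 - 3 = N := by omega
  have d1 : (48 * q + 22 - 1) / 3 = 16 * q + 7 := by omega
  have d2 : (48 * q + 22 - 4) / 3 = 16 * q + 6 := by omega
  have d3 : (48 * q + 22 - 7) / 3 = 16 * q + 5 := by omega
  rw [e1, e2, d1] at hj1
  rw [e1, e2, d2] at hj2
  rw [e1, e2, e3, d3] at hj3
  have hne (k : Fin N) : (k : ℕ) ≠ N ∧ (k : ℕ) ≠ N + 1 ∧ (k : ℕ) ≠ N + 2 := by
    have := k.2
    omega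
  have hz (k : Fin N) : j1 k.castSucc.castSucc.castSucc = 0 := by simp [hj1, hne k]
  have hc : j1 (Fin.last N).castSucc.castSucc = 0 := by simp [hj1]
  have hb : j1 (Fin.last (N + 1)).castSucc = 16 * q + 7 := by simp [hj1]
  have ha : j1 (Fin.last (N + 2)) = 2 := by simp [hj1]
  have hα := alphaF_last_eq j1 hz hc hb
  have hP1 : Pprod (N + 3) (48 * q + 22) j1 ≠ 0 := by
    refine Finset.prod_ne_zero_iff.mpr fun k _ => ?_
    refine Fin.lastCases ?_ (fun k => ?_) k
    · rw [hα, ha, genBinom_neg_two]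
      positivity
    · have hk := k.2
      refine genBinom_ne_zero_of_padicValRat_neg ?_ _
      rw [padicValRat_alphaF (by omega) _ _ (by simp), Fin.val_castSucc]
      omega
  have hV1 : V (N + 3) (48 * q + 22) j1 = 32 * q + 10 - sdig q := by
    have e0 : sdig 0 = 0 := by simp [sdig]
    rw [V_add_three_eq (by omega) j1 hP1, hα, hb, hc, ha, padicValRat_genBinom_neg_two,
      sdig_sixteen_mul_add_seven]
    simp [hz, e0]
    ring
  refine ⟨?_, hP1, fun j hJ n1 n2 n3 => or_iff_not_imp_left.mpr fun hP => ?_⟩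
  · rw [inJ_add_three_iff, hb, hc, ha]
    simp [hz]
    ring
  · rw [hV1]
    refine V_lt_of_digit_sum_bound j hJ hP ?_
    rintro c b a (⟨rfl, rfl, rfl⟩ | ⟨rfl, rfl, rfl⟩ | ⟨rfl, rfl, rfl⟩) ⟨h0, h3, h2, h1⟩
    · exact n1 (funext_add_three (fun k => by simp [hj1, hne k, h0]) (by simp [hj1, h3])
        (by simp [hj1, h2]) (by simp [hj1, h1]))
    · exact n2 (funext_add_three (fun k => by simp [hj2, hne k, h0]) (by simp [hj2, h3])
        (by simp [hj2, h2]) (by simp [hj2, h1]))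
    · exact n3 (funext_add_three (fun k => by simp [hj3, hne k, h0]) (by simp [hj3, h3])
        (by simp [hj3, h2]) (by simp [hj3, h1]))
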